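/- arXiv:2105.00178 — 3 statements merged into one kernel-verified Lean document; each statement's English description precedes it below -/
import Mathlib

section
/- For every nonzero r ∈ 𝔽ⁿ there exists an r-interpolator R whose degree ρ satisfies ρ ≤ n − γ + 2g − 1; that is, there is an integer ρ ≤ n − γ + 2g − 1 and R ∈ L(G + ρP_∞) with R ∉ L(G + (ρ−1)P_∞) and R(Pᵢ) = rᵢ for i = 1, …, n. -/
open scoped Classical

/-- An abstract algebraic function field `F` over the base field `𝔽`, together with its
places (with their additive valuations, degrees and residue evaluation maps),
its Riemann–Roch spaces `L A` for divisors `A` (finitely supported `ℤ`-valued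
functions on places), and its genus `g`, axiomatized by the standard properties,
including Riemann's inequality and the exact dimension formula for divisors of
large degree. -/
structure FnFld (𝔽 F : Type) [Field 𝔽] [Field F] [Algebra 𝔽 F] where
  /-- the places of `F` -/
  Place : Type
  /-- the (additive, surjective onto `ℤ`) valuation attached to a place -/
  v : Place → F → WithTop ℤ
  v_zero : ∀ P, v P 0 = ⊤
  v_ne_top : ∀ P (x : F), x ≠ 0 → v P x ≠ ⊤
  v_mul : ∀ P (x y : F), v P (x * y) = v P x + v P y
  v_add : ∀ P (x y : F), min (v P x) (v P y) ≤ v P (x + y)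
  v_surj : ∀ P (m : ℤ), ∃ x : F, v P x = (m : WithTop ℤ)
  v_const : ∀ P (c : 𝔽), c ≠ 0 → v P (algebraMap 𝔽 F c) = 0
  v_finite : ∀ x : F, x ≠ 0 → {P | v P x ≠ 0}.Finite
  /-- the degree of a place -/
  pdeg : Place → ℕ
  pdeg_pos : ∀ P, 0 < pdeg P
  /-- evaluation of a function at a (rational) place; junk value unless
  `pdeg P = 1` and `0 ≤ v P x` -/
  ev : Place → F → 𝔽
  ev_add : ∀ P (x y : F), pdeg P = 1 → 0 ≤ v P x → 0 ≤ v P y →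
    ev P (x + y) = ev P x + ev P y
  ev_mul : ∀ P (x y : F), pdeg P = 1 → 0 ≤ v P x → 0 ≤ v P y →
    ev P (x * y) = ev P x * ev P y
  ev_const : ∀ P (c : 𝔽), ev P (algebraMap 𝔽 F c) = c
  ev_eq_zero_iff : ∀ P (x : F), pdeg P = 1 → 0 ≤ v P x → (ev P x = 0 ↔ 0 < v P x)
  /-- the Riemann–Roch space of a divisor `A`:
  `L A = {x ∈ F \ {0} : (x) ≥ -A} ∪ {0}` -/
  L : (Place →₀ ℤ) → Submodule 𝔽 F
  mem_L : ∀ (A : Place →₀ ℤ) (x : F), x ∈ L A ↔ ∀ P, ((-(A P) : ℤ) : WithTop ℤ) ≤ v P x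
  finiteDim : ∀ A, FiniteDimensional 𝔽 (L A)
  /-- the genus -/
  g : ℕ
  /-- Riemann's inequality : `𝔩(A) ≥ deg A + 1 - g` -/
  riemann : ∀ A : Place →₀ ℤ,
    (A.sum fun P m => m * pdeg P) + 1 - g ≤ (Module.finrank 𝔽 (L A) : ℤ)
  /-- `𝔩(A) = deg A + 1 - g` whenever `deg A ≥ 2g - 1` -/
  dim_L_eq : ∀ A : Place →₀ ℤ, 2 * (g : ℤ) - 1 ≤ (A.sum fun P m => m * pdeg P) →
    (Module.finrank 𝔽 (L A) : ℤ) = (A.sum fun P m => m * pdeg P) + 1 - g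

namespace FnFld

variable {𝔽 F : Type} [Field 𝔽] [Field F] [Algebra 𝔽 F] (K : FnFld 𝔽 F)

/-- The degree of a divisor. -/
def deg (A : K.Place →₀ ℤ) : ℤ := A.sum fun P m => m * K.pdeg P

/-- `𝔩(A)`, the `𝔽`-dimension of the Riemann–Roch space `L(A)`. -/
noncomputable def dimL (A : K.Place →₀ ℤ) : ℕ := Module.finrank 𝔽 (K.L A)

/-- A place is rational if it has degree one. -/
def IsRational (P : K.Place) : Prop := K.pdeg P = 1

/-- The divisor consisting of a single (simple) place. -/
noncomputable def onePt (P : K.Place) : K.Place →₀ ℤ := Finsupp.single P 1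

/-- `R` is an `r`-interpolator of degree `ρ`:
`R ∈ L(G + ρ P∞) \ L(G + (ρ-1) P∞)` and `R(Pᵢ) = rᵢ` for all `i`. -/
def IsInterpolator {n : ℕ} (P : Fin n → K.Place) (Pinf : K.Place)
    (G : K.Place →₀ ℤ) (r : Fin n → 𝔽) (ρ : ℤ) (R : F) : Prop :=
  R ∈ K.L (G + ρ • K.onePt Pinf) ∧ R ∉ K.L (G + (ρ - 1) • K.onePt Pinf) ∧
    ∀ i, K.ev (P i) R = r i

/-- `Λ` is an error locator with multiplicity `s` and degree `lam` (w.r.t. the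
error divisor `E`): `Λ ∈ L(lam P∞ - s E) \ L((lam - 1) P∞ - s E)`. -/
def IsErrLocator (Pinf : K.Place) (E : K.Place →₀ ℤ) (s : ℕ) (lam : ℤ) (Λ : F) : Prop :=
  Λ ∈ K.L (lam • K.onePt Pinf - (s : ℤ) • E) ∧
    Λ ∉ K.L ((lam - 1) • K.onePt Pinf - (s : ℤ) • E)

/-- The divisor `V_t = λ_s P∞ + t G`. -/
noncomputable def Vdiv (Pinf : K.Place) (G : K.Place →₀ ℤ) (lam : ℤ) (t : ℕ) :
    K.Place →₀ ℤ := lam • K.onePt Pinf + (t : ℤ) • G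

/-- The divisor `Q_t = λ_s P∞ + t (G + ρ P∞)`. -/
noncomputable def Qdiv (Pinf : K.Place) (G : K.Place →₀ ℤ) (lam ρ : ℤ) (t : ℕ) :
    K.Place →₀ ℤ := lam • K.onePt Pinf + (t : ℤ) • (G + ρ • K.onePt Pinf)

/-- The divisor `W_j = λ_s P∞ + j (G + ρ P∞ - D)`. -/
noncomputable def Wdiv (Pinf : K.Place) (G D : K.Place →₀ ℤ) (lam ρ : ℤ) (j : ℕ) :
    K.Place →₀ ℤ := lam • K.onePt Pinf + (j : ℤ) • (G + ρ • K.onePt Pinf - D)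

end FnFld

namespace FnFld

variable {𝔽 F : Type} [Field 𝔽] [Field F] [Algebra 𝔽 F] (K : FnFld 𝔽 F)

theorem deg_add (A B : K.Place →₀ ℤ) : K.deg (A + B) = K.deg A + K.deg B :=
  Finsupp.sum_add_index' (by simp) (by intros; ring)

theorem deg_single (P : K.Place) (m : ℤ) :
    K.deg (Finsupp.single P m) = m * K.pdeg P :=
  Finsupp.sum_single_index (by simp)

theorem deg_sum_single {n : ℕ} (P : Fin n → K.Place) (m : ℤ) :
    K.deg (∑ i, Finsupp.single (P i) m) = ∑ i, m * (K.pdeg (P i) : ℤ) := by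
  let φ : (K.Place →₀ ℤ) →+ ℤ :=
    { toFun := K.deg, map_zero' := Finsupp.sum_zero_index, map_add' := K.deg_add }
  have h : K.deg (∑ i, Finsupp.single (P i) m) = ∑ i, K.deg (Finsupp.single (P i) m) :=
    map_sum φ _ _
  simp only [h, deg_single]

theorem v_algebraMap_nonneg (P : K.Place) (c : 𝔽) : 0 ≤ K.v P (algebraMap 𝔽 F c) := by
  by_cases hc : c = 0
  · simp [hc, K.v_zero]
  · exact (K.v_const P c hc).ge

theorem ev_zero (P : K.Place) : K.ev P 0 = 0 := by
  simpa using K.ev_const P 0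

theorem v_nonneg_of_mem_L {A : K.Place →₀ ℤ} {P : K.Place} (hA : A P = 0) {x : F}
    (hx : x ∈ K.L A) : 0 ≤ K.v P x := by
  simpa [hA] using (K.mem_L A x).1 hx P

/-- Evaluation at rational places outside the support of `A`, as a linear map on `L A`. -/
def evalMap {n : ℕ} (A : K.Place →₀ ℤ) (P : Fin n → K.Place)
    (hP : ∀ i, K.IsRational (P i)) (hA : ∀ i, A (P i) = 0) : K.L A →ₗ[𝔽] (Fin n → 𝔽) where
  toFun x i := K.ev (P i) x
  map_add' x y := funext fun i => K.ev_add _ _ _ (hP i)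
    (K.v_nonneg_of_mem_L (hA i) x.2) (K.v_nonneg_of_mem_L (hA i) y.2)
  map_smul' c x := funext fun i => by
    simp [Algebra.smul_def, K.ev_mul _ _ _ (hP i) (K.v_algebraMap_nonneg _ c)
      (K.v_nonneg_of_mem_L (hA i) x.2), K.ev_const]

theorem mem_ker_evalMap_iff {n : ℕ} (A : K.Place →₀ ℤ) (P : Fin n → K.Place)
    (hP : ∀ i, K.IsRational (P i)) (hinj : Function.Injective P) (hA : ∀ i, A (P i) = 0)
    (x : K.L A) :
    x ∈ LinearMap.ker (K.evalMap A P hP hA) ↔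
      (x : F) ∈ K.L (A + ∑ i, Finsupp.single (P i) (-1)) := by
  have hv := (K.mem_L A x).1 x.2
  have hpos (Q : K.Place) : (0 < K.v Q x) ↔ ((1 : ℤ) : WithTop ℤ) ≤ K.v Q x := by
    cases h : K.v Q x with
    | top => simp
    | coe m =>
      norm_cast
  have hker : x ∈ LinearMap.ker (K.evalMap A P hP hA) ↔ ∀ i, 0 < K.v (P i) x := by
    rw [LinearMap.mem_ker, funext_iff]
    exact forall_congr' fun i =>
      K.ev_eq_zero_iff _ _ (hP i) (K.v_nonneg_of_mem_L (hA i) x.2)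
  have hat (i : Fin n) : (A + ∑ j, Finsupp.single (P j) (-1 : ℤ)) (P i) = -1 := by
    simp [Finsupp.single_apply, hA, hinj.eq_iff]
  have hoff (Q : K.Place) (hQ : ∀ i, P i ≠ Q) :
      (A + ∑ j, Finsupp.single (P j) (-1 : ℤ)) Q = A Q := by
    simp [hQ]
  rw [hker, K.mem_L]
  constructor
  · intro h Q
    by_cases hQ : ∃ i, P i = Q
    · obtain ⟨i, rfl⟩ := hQ
      rw [hat, neg_neg]
      exact (hpos _).1 (h i)
    · rw [hoff Q (not_exists.1 hQ)]
      exact hv Q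
  · intro h i
    have hi := h (P i)
    rw [hat, neg_neg] at hi
    exact (hpos _).2 hi

theorem L_add_sum_single_le {n : ℕ} (A : K.Place →₀ ℤ) (P : Fin n → K.Place) :
    K.L (A + ∑ i, Finsupp.single (P i) (-1)) ≤ K.L A := by
  intro x hx
  rw [K.mem_L] at hx ⊢
  refine fun Q => le_trans (WithTop.coe_le_coe.2 (neg_le_neg ?_)) (hx Q)
  rw [Finsupp.add_apply, Finsupp.finsetSum_apply]
  have : ∑ i, (Finsupp.single (P i) (-1 : ℤ)) Q ≤ 0 :=
    Finset.sum_nonpos fun i _ => by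
      rw [Finsupp.single_apply]
      split_ifs <;> norm_num
  linarith

theorem evalMap_surjective {n : ℕ} (A : K.Place →₀ ℤ) (P : Fin n → K.Place)
    (hP : ∀ i, K.IsRational (P i)) (hinj : Function.Injective P) (hA : ∀ i, A (P i) = 0)
    (hdeg : (n : ℤ) + 2 * K.g - 1 ≤ K.deg A) :
    Function.Surjective (K.evalMap A P hP hA) := by
  have := K.finiteDim A
  have hker : LinearMap.ker (K.evalMap A P hP hA) =
      (K.L (A + ∑ i, Finsupp.single (P i) (-1))).submoduleOf (K.L A) := by
    ext x
    exact K.mem_ker_evalMap_iff A P hP hinj hA x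
  have hfin : Module.finrank 𝔽 (LinearMap.ker (K.evalMap A P hP hA)) =
      Module.finrank 𝔽 (K.L (A + ∑ i, Finsupp.single (P i) (-1))) := by
    rw [hker]
    exact (Submodule.submoduleOfEquivOfLe (K.L_add_sum_single_le A P)).finrank_eq
  have hD : K.deg (A + ∑ i, Finsupp.single (P i) (-1)) = K.deg A - n := by
    have hP' (i : Fin n) : K.pdeg (P i) = 1 := hP i
    simp only [deg_add, deg_sum_single, hP']
    simp [sub_eq_add_neg]
  have h₁ : (Module.finrank 𝔽 (K.L A) : ℤ) = K.deg A + 1 - K.g :=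
    K.dim_L_eq A (by change _ ≤ K.deg A; linarith [Int.natCast_nonneg n])
  have h₂ : (Module.finrank 𝔽 (K.L (A + ∑ i, Finsupp.single (P i) (-1))) : ℤ) =
      K.deg (A + ∑ i, Finsupp.single (P i) (-1)) + 1 - K.g :=
    K.dim_L_eq _ (by change _ ≤ K.deg _; linarith)
  have h₃ := LinearMap.finrank_range_add_finrank_ker (K.evalMap A P hP hA)
  refine LinearMap.range_eq_top.1 (Submodule.eq_top_of_finrank_eq ?_)
  rw [Module.finrank_fin_fun]
  omega

end FnFld

/-- For every nonzero `r ∈ 𝔽ⁿ` there exists an `r`-interpolator `R`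
whose degree `ρ` satisfies `ρ ≤ n - γ + 2g - 1`. -/
theorem exists_interpolator
    {𝔽 F : Type} [Field 𝔽] [Field F] [Algebra 𝔽 F] (K : FnFld 𝔽 F)
    (n : ℕ) (P : Fin n → K.Place) (Pinf : K.Place)
    (hPrat : ∀ i, K.IsRational (P i)) (hPinfrat : K.IsRational Pinf)
    (hPinj : Function.Injective P) (hPne : ∀ i, P i ≠ Pinf)
    (G : K.Place →₀ ℤ) (γ : ℤ) (hG : K.deg G = γ)
    (hGP : ∀ i, G (P i) = 0) (hGinf : G Pinf = 0)
    (r : Fin n → 𝔽) (hr : r ≠ 0) :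
    ∃ ρ : ℤ, ρ ≤ (n : ℤ) - γ + 2 * K.g - 1 ∧
      ∃ R : F, K.IsInterpolator P Pinf G r ρ R := by
  obtain ⟨i₀, hi₀⟩ : ∃ i, r i ≠ 0 := Function.ne_iff.1 hr
  set A : K.Place →₀ ℤ := G + Finsupp.single Pinf ((n : ℤ) - γ + 2 * K.g - 1) with hAdef
  have hAP (i : Fin n) : A (P i) = 0 := by
    simp [hAdef, hGP, (hPne i).symm]
  have hAdeg : K.deg A = (n : ℤ) + 2 * K.g - 1 := by
    have hPinf' : K.pdeg Pinf = 1 := hPinfrat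
    rw [hAdef, K.deg_add, K.deg_single, hG, hPinf']
    push_cast
    ring
  obtain ⟨⟨R, hRA⟩, hR⟩ := K.evalMap_surjective A P hPrat hPinj hAP hAdeg.ge r
  have hev (i : Fin n) : K.ev (P i) R = r i := congrFun hR i
  have hR0 : R ≠ 0 := by
    rintro rfl
    exact hi₀ (by rw [← hev, K.ev_zero])
  obtain ⟨m, hm⟩ := WithTop.ne_top_iff_exists.1 (K.v_ne_top Pinf R hR0)
  have hv := (K.mem_L A R).1 hRA
  refine ⟨-m, ?_, R, ?_, ?_, hev⟩
  · have h := hv Pinf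
    rw [← hm, WithTop.coe_le_coe] at h
    simp only [hAdef, Finsupp.add_apply, Finsupp.single_eq_same, hGinf] at h
    linarith
  · rw [K.mem_L]
    intro Q
    by_cases hQ : Q = Pinf
    · subst hQ
      rw [← hm, WithTop.coe_le_coe]
      simp [FnFld.onePt, hGinf]
    · have h := hv Q
      simpa [hAdef, FnFld.onePt, Finsupp.single_apply, Ne.symm hQ] using h
  · rw [K.mem_L]
    intro h
    have h' := h Pinf
    rw [← hm, WithTop.coe_le_coe] at h'
    simp only [FnFld.onePt, Finsupp.add_apply, Finsupp.smul_apply, Finsupp.single_eq_same,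
      hGinf, smul_eq_mul] at h'
    linarith
end

section
/- Suppose γ ≥ 2g − 2, 1 ≤ s ≤ ℓ, λ_s ≥ 0 and ρ ≥ 1, and let ν and ε be as in the preceding bounds. If λ_s > s·(2ℓ − s + 1)/(2(ℓ+1))·n − (ℓ/2)·γ + ℓ/(ℓ+1) + g, then ν > ε + 1; consequently, the homogeneous 𝔽-linear system U·u = 0 of the linearized key-equation system (having at most ε equations in ν unknowns) has at least two 𝔽-linearly independent solutions. -/
open scoped Classical

namespace FnFld

variable {𝔽 F : Type} [Field 𝔽] [Field F] [Algebra 𝔽 F] (K : FnFld 𝔽 F)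

/-- The degree as a homomorphism from the divisor group to `ℤ`. -/
noncomputable def degHom : (K.Place →₀ ℤ) →+ ℤ := AddMonoidHom.mk' K.deg K.deg_add

theorem deg_sub (A B : K.Place →₀ ℤ) : K.deg (A - B) = K.deg A - K.deg B :=
  map_sub K.degHom A B

theorem deg_zsmul (m : ℤ) (A : K.Place →₀ ℤ) : K.deg (m • A) = m * K.deg A :=
  (map_zsmul K.degHom m A).trans (smul_eq_mul _ _)

theorem deg_sum {ι : Type*} (S : Finset ι) (A : ι → K.Place →₀ ℤ) :
    K.deg (∑ i ∈ S, A i) = ∑ i ∈ S, K.deg (A i) :=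
  map_sum K.degHom A S

theorem deg_onePt {P : K.Place} (hP : K.IsRational P) : K.deg (K.onePt P) = 1 := by
  unfold IsRational at hP
  simp [deg, onePt, hP]

theorem deg_add_one_sub_le_dimL (A : K.Place →₀ ℤ) :
    K.deg A + 1 - K.g ≤ (K.dimL A : ℤ) :=
  K.riemann A

theorem dimL_eq_of_le_deg {A : K.Place →₀ ℤ} (hA : 2 * (K.g : ℤ) - 1 ≤ K.deg A) :
    (K.dimL A : ℤ) = K.deg A + 1 - K.g :=
  K.dim_L_eq A hA

variable {Pinf : K.Place} (G D : K.Place →₀ ℤ) (lam ρ : ℤ)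

theorem deg_Vdiv (hP : K.IsRational Pinf) (t : ℕ) :
    K.deg (K.Vdiv Pinf G lam t) = lam + t * K.deg G := by
  simp only [Vdiv, deg_add, deg_zsmul, deg_onePt K hP, mul_one]

theorem deg_Qdiv (hP : K.IsRational Pinf) (t : ℕ) :
    K.deg (K.Qdiv Pinf G lam ρ t) = lam + t * (K.deg G + ρ) := by
  simp only [Qdiv, deg_add, deg_zsmul, deg_onePt K hP, mul_one]

theorem deg_Wdiv (hP : K.IsRational Pinf) (j : ℕ) :
    K.deg (K.Wdiv Pinf G D lam ρ j) = lam + j * (K.deg G + ρ - K.deg D) := by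
  simp only [Wdiv, deg_add, deg_sub, deg_zsmul, deg_onePt K hP, mul_one]

end FnFld

theorem two_mul_sum_Icc_affine (a b : ℤ) {m n : ℕ} (h : m ≤ n + 1) :
    2 * ∑ t ∈ Finset.Icc m n, (a + t * b) =
      2 * ((n : ℤ) - m + 1) * a + ((n : ℤ) * (n + 1) - m * (m - 1)) * b := by
  induction n with
  | zero =>
    obtain rfl | rfl : m = 0 ∨ m = 1 := by omega
    all_goals simp
  | succ k ih =>
    rcases h.lt_or_eq with h | rfl
    · rw [Finset.sum_Icc_succ_top (by omega), mul_add, ih (by omega)]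
      push_cast
      ring
    · rw [Finset.Icc_eq_empty (by omega)]
      push_cast
      simp
      ring_nf
      simp

theorem two_mul_sum_range_affine (a b : ℤ) (n : ℕ) :
    2 * ∑ t ∈ Finset.range n, (a + t * b) = 2 * (n : ℤ) * a + (n : ℤ) * (n - 1) * b := by
  induction n with
  | zero => simp
  | succ k ih =>
    rw [Finset.sum_range_succ, mul_add, ih]
    push_cast
    ring

theorem Matrix.exists_linearIndependent_pair_mulVec_eq_zero {𝔽 : Type*} [Field 𝔽] {a c : ℕ}
    (hac : a + 1 < c) (M : Matrix (Fin a) (Fin c) 𝔽) :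
    ∃ u₁ u₂ : Fin c → 𝔽, M.mulVec u₁ = 0 ∧ M.mulVec u₂ = 0 ∧
      LinearIndependent 𝔽 ![u₁, u₂] := by
  have hrank := M.mulVecLin.finrank_range_add_finrank_ker
  have hle := Submodule.finrank_le (LinearMap.range M.mulVecLin)
  simp only [Module.finrank_fin_fun] at hrank hle
  obtain ⟨u, hu⟩ := exists_linearIndependent_of_le_finrank
    (show 2 ≤ Module.finrank 𝔽 (LinearMap.ker M.mulVecLin) by omega)
  refine ⟨u 0, u 1, (u 0).2, (u 1).2, ?_⟩
  have hu' := hu.map' (LinearMap.ker M.mulVecLin).subtype (Submodule.ker_subtype _)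
  have hpair : ![(u 0 : Fin c → 𝔽), u 1] = (LinearMap.ker M.mulVecLin).subtype ∘ u := by
    ext i
    fin_cases i <;> rfl
  rw [hpair]
  exact hu'

/-- If `λ_s > s(2ℓ - s + 1)/(2(ℓ+1))·n - (ℓ/2)γ + ℓ/(ℓ+1) + g`, then
`ν > ε + 1`; consequently any homogeneous `𝔽`-linear system with at most `ε` equations
in `ν` unknowns has at least two `𝔽`-linearly independent solutions. -/
theorem failure_of_decoding
    {𝔽 F : Type} [Field 𝔽] [Field F] [Algebra 𝔽 F] (K : FnFld 𝔽 F)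
    (n : ℕ) (P : Fin n → K.Place) (Pinf : K.Place)
    (hPrat : ∀ i, K.IsRational (P i)) (hPinfrat : K.IsRational Pinf)
    (hPinj : Function.Injective P) (hPne : ∀ i, P i ≠ Pinf)
    (G : K.Place →₀ ℤ) (γ : ℤ) (hG : K.deg G = γ) (hγ : 2 * (K.g : ℤ) - 2 ≤ γ)
    (hGP : ∀ i, G (P i) = 0) (hGinf : G Pinf = 0)
    (D : K.Place →₀ ℤ) (hD : D = ∑ i, K.onePt (P i))
    (s ℓ : ℕ) (hs : 1 ≤ s) (hsℓ : s ≤ ℓ)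
    (lam : ℤ) (hlam : 0 ≤ lam) (ρ : ℤ) (hρ : 1 ≤ ρ)
    (ν ε : ℤ)
    (hν : ν = (∑ t ∈ Finset.Icc 1 ℓ, (K.dimL (K.Vdiv Pinf G lam t) : ℤ)) +
      ∑ j ∈ Finset.range s, (K.dimL (K.Wdiv Pinf G D lam ρ j) : ℤ))
    (hε : ε = (∑ t ∈ Finset.Icc 1 (s - 1), (K.dimL (K.Qdiv Pinf G lam ρ t) : ℤ)) +
      ∑ t ∈ Finset.Icc s ℓ,
        ((K.dimL (K.Qdiv Pinf G lam ρ t) : ℤ) -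
          (K.dimL (K.Qdiv Pinf G lam ρ t - (s : ℤ) • D) : ℤ)))
    (hbig : (s : ℚ) * (2 * ℓ - s + 1) / (2 * (ℓ + 1)) * n - (ℓ : ℚ) / 2 * γ +
        (ℓ : ℚ) / (ℓ + 1) + K.g < (lam : ℚ)) :
    ν > ε + 1 ∧
    ∀ (a c : ℕ), (a : ℤ) ≤ ε → (c : ℤ) = ν →
      ∀ Umat : Matrix (Fin a) (Fin c) 𝔽,
        ∃ u₁ u₂ : Fin c → 𝔽, Umat.mulVec u₁ = 0 ∧ Umat.mulVec u₂ = 0 ∧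
          LinearIndependent 𝔽 ![u₁, u₂] := by
  have hgap : ν > ε + 1 := by
    have hdegD : K.deg D = n := by
      simp [hD, K.deg_sum, K.deg_onePt (hPrat _)]
    have hlamZ : (s : ℤ) * (2 * ℓ - s + 1) * n - ℓ * (ℓ + 1) * γ + 2 * ℓ
        + 2 * (ℓ + 1) * K.g < 2 * (ℓ + 1) * lam := by
      have h := mul_lt_mul_of_pos_left hbig (show (0 : ℚ) < 2 * (ℓ + 1) by positivity)
      have h2 : (2 * (ℓ + 1) : ℚ) * ((s : ℚ) * (2 * ℓ - s + 1) / (2 * (ℓ + 1)) * n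
          - (ℓ : ℚ) / 2 * γ + (ℓ : ℚ) / (ℓ + 1) + K.g) =
          (s : ℚ) * (2 * ℓ - s + 1) * n - ℓ * (ℓ + 1) * γ + 2 * ℓ + 2 * (ℓ + 1) * K.g := by
        field_simp
      rw [h2] at h
      exact_mod_cast h
    have hs' : (1 : ℤ) ≤ s := by exact_mod_cast hs
    have hsℓ' : (s : ℤ) ≤ ℓ := by exact_mod_cast hsℓ
    have hdegQ : ∀ t : ℕ, 1 ≤ t → t ≤ ℓ → 2 * (K.g : ℤ) - 1 ≤ lam + t * (γ + ρ) := by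
      intro t ht htℓ
      have ht' : (1 : ℤ) ≤ t := by exact_mod_cast ht
      have htℓ' : (t : ℤ) ≤ ℓ := by exact_mod_cast htℓ
      rcases le_or_gt 0 (γ + ρ) with h | h
      · nlinarith
      · have hg : (K.g : ℤ) = 0 := by omega
        have hγ2 : γ = -2 := by omega
        have hρ1 : ρ = 1 := by omega
        have hn : 0 ≤ (s : ℤ) * (2 * ℓ - s + 1) * n :=
          mul_nonneg (mul_nonneg (by omega) (by omega)) (by positivity)
        subst hγ2 hρ1
        rw [hg] at hlamZ ⊢
        have : (ℓ : ℤ) < lam := by nlinarith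
        linarith
    have hQ : ∀ t : ℕ, 1 ≤ t → t ≤ ℓ →
        (K.dimL (K.Qdiv Pinf G lam ρ t) : ℤ) = (lam + 1 - K.g) + t * (γ + ρ) := by
      intro t ht htℓ
      rw [K.dimL_eq_of_le_deg] <;> rw [K.deg_Qdiv (hP := hPinfrat), hG]
      · ring
      · exact hdegQ t ht htℓ
    have hVsum : ∑ t ∈ Finset.Icc 1 ℓ, ((lam + 1 - K.g) + t * γ) ≤
        ∑ t ∈ Finset.Icc 1 ℓ, (K.dimL (K.Vdiv Pinf G lam t) : ℤ) := by
      refine Finset.sum_le_sum fun t _ => ?_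
      have h := K.deg_add_one_sub_le_dimL (K.Vdiv Pinf G lam t)
      rw [K.deg_Vdiv (hP := hPinfrat), hG] at h
      linarith
    have hWsum : ∑ j ∈ Finset.range s, ((lam + 1 - K.g) + j * (γ + ρ - n)) ≤
        ∑ j ∈ Finset.range s, (K.dimL (K.Wdiv Pinf G D lam ρ j) : ℤ) := by
      refine Finset.sum_le_sum fun j _ => ?_
      have h := K.deg_add_one_sub_le_dimL (K.Wdiv Pinf G D lam ρ j)
      rw [K.deg_Wdiv (hP := hPinfrat), hG, hdegD] at h
      linarith
    have hQsum : ∑ t ∈ Finset.Icc 1 (s - 1), (K.dimL (K.Qdiv Pinf G lam ρ t) : ℤ) =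
        ∑ t ∈ Finset.Icc 1 (s - 1), ((lam + 1 - K.g) + t * (γ + ρ)) := by
      refine Finset.sum_congr rfl fun t ht => ?_
      rw [Finset.mem_Icc] at ht
      exact hQ t ht.1 (by omega)
    have hQDsum : ∑ t ∈ Finset.Icc s ℓ, ((K.dimL (K.Qdiv Pinf G lam ρ t) : ℤ) -
        (K.dimL (K.Qdiv Pinf G lam ρ t - (s : ℤ) • D) : ℤ)) ≤
        ∑ t ∈ Finset.Icc s ℓ, ((s * n : ℤ) + t * 0) := by
      refine Finset.sum_le_sum fun t ht => ?_
      rw [Finset.mem_Icc] at ht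
      have h := K.deg_add_one_sub_le_dimL (K.Qdiv Pinf G lam ρ t - (s : ℤ) • D)
      rw [K.deg_sub, K.deg_zsmul, K.deg_Qdiv (hP := hPinfrat), hG, hdegD] at h
      rw [hQ t (by omega) ht.2]
      linarith
    have hVval := two_mul_sum_Icc_affine (lam + 1 - K.g) γ (show 1 ≤ ℓ + 1 by omega)
    have hWval := two_mul_sum_range_affine (lam + 1 - K.g) (γ + ρ - n) s
    have hQval := two_mul_sum_Icc_affine (lam + 1 - K.g) (γ + ρ) (show 1 ≤ s - 1 + 1 by omega)
    have hQDval := two_mul_sum_Icc_affine (s * n) 0 (show s ≤ ℓ + 1 by omega)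
    push_cast [hs] at hVval hQval
    rw [hν, hε, hQsum]
    nlinarith
  refine ⟨hgap, fun a c ha hc M => ?_⟩
  exact M.exists_linearIndependent_pair_mulVec_eq_zero (by omega)
end

section
/- Let n and γ be integers with 0 < γ < n, and for integers 1 ≤ s ≤ ℓ define T(ℓ,s) = (2ℓ − s + 1)/(2(ℓ+1))·n − (ℓ/(2s))·γ + ℓ/(s(ℓ+1)), so that the decoding radius is τ_max(ℓ,s) = ⌊T(ℓ,s)⌋. Set ℓ_i = i and s_i = ⌊√(γ/n)·i⌋ + 1 for i ∈ ℤ_{>0}. Then there exists a constant C > 0 (depending only on n and γ) such that for all i ≥ 1: |T(ℓ_i, s_i) − (n − √(nγ))| ≤ C/i; in particular τ_max(ℓ_i, s_i) ≥ n·(1 − √(γ/n)) − C/i − 1, so the decoding radius asymptotically reaches the Johnson radius n(1 − √(γ/n)). -/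
/-- The gap between the real-valued decoding radius with parameters `x` and `s`, where
`a * x < s ≤ a * x + 1`, and the Johnson radius `N - N * a`. -/
lemma abs_radius_sub_johnson_le {N a x s : ℝ} (hN : 0 < N) (ha : 0 < a) (ha1 : a < 1)
    (hx : 0 < x) (hs : a * x < s) (hs1 : s ≤ a * x + 1) :
    |(2 * x - s + 1) / (2 * (x + 1)) * N - x / (2 * s) * (a ^ 2 * N) + x / (s * (x + 1))
      - (N - N * a)| ≤ (2 * N + 1 / a) / x := by
  have hax : 0 < a * x := mul_pos ha hx
  have hs0 : 0 < s := hax.trans hs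
  have decomp : (2 * x - s + 1) / (2 * (x + 1)) * N - x / (2 * s) * (a ^ 2 * N)
      + x / (s * (x + 1)) - (N - N * a) =
      N * ((a * (x + 1) - s - 1) / (2 * (x + 1))) + N * (a * (s - a * x) / (2 * s))
        + x / (s * (x + 1)) := by
    field_simp
    ring
  have floor_term : |(a * (x + 1) - s - 1) / (2 * (x + 1))| ≤ 1 / x := by
    rw [abs_div, abs_of_pos (by positivity : 0 < 2 * (x + 1)), div_le_div_iff₀ (by positivity) hx]
    have : |a * (x + 1) - s - 1| ≤ 2 := abs_le.2 ⟨by linarith, by linarith⟩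
    nlinarith
  have excess_term : |a * (s - a * x) / (2 * s)| ≤ 1 / x := by
    rw [abs_of_nonneg (div_nonneg (mul_nonneg ha.le (by linarith)) (by positivity)),
      div_le_div_iff₀ (by positivity) hx]
    nlinarith
  have last_term : |x / (s * (x + 1))| ≤ 1 / a / x := by
    rw [abs_of_pos (by positivity), div_div, div_le_div_iff₀ (by positivity) hax]
    nlinarith
  rw [decomp]
  calc _ ≤ |N * ((a * (x + 1) - s - 1) / (2 * (x + 1)))| + |N * (a * (s - a * x) / (2 * s))|
        + |x / (s * (x + 1))| := abs_add_three _ _ _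
    _ ≤ N * (1 / x) + N * (1 / x) + 1 / a / x := by
      rw [abs_mul, abs_mul, abs_of_pos hN]
      gcongr
    _ = (2 * N + 1 / a) / x := by ring


/-- For integers `0 < γ < n`, with
`T(ℓ,s) = (2ℓ - s + 1)/(2(ℓ+1))·n - (ℓ/(2s))·γ + ℓ/(s(ℓ+1))` (so that the decoding
radius is `τ_max(ℓ,s) = ⌊T(ℓ,s)⌋`), setting `ℓ_i = i` and `s_i = ⌊√(γ/n)·i⌋ + 1`, there
is a constant `C > 0` (depending only on `n` and `γ`) such that for all `i ≥ 1`,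
`|T(ℓ_i, s_i) - (n - √(nγ))| ≤ C/i`; in particular
`τ_max(ℓ_i, s_i) ≥ n(1 - √(γ/n)) - C/i - 1`, so the decoding radius asymptotically
reaches the Johnson radius `n(1 - √(γ/n))`. -/
theorem decoding_radius_achieves_johnson_radius
    (n γ : ℤ) (hγ : 0 < γ) (hn : γ < n) :
    ∃ C : ℝ, 0 < C ∧ ∀ i : ℕ, 1 ≤ i →
      ∀ s : ℤ, s = ⌊Real.sqrt ((γ : ℝ) / n) * i⌋ + 1 →
      ∀ T : ℝ, T = (2 * (i : ℝ) - s + 1) / (2 * ((i : ℝ) + 1)) * n -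
          (i : ℝ) / (2 * s) * γ + (i : ℝ) / (s * ((i : ℝ) + 1)) →
        |T - ((n : ℝ) - Real.sqrt ((n : ℝ) * γ))| ≤ C / i ∧
        ((⌊T⌋ : ℝ) ≥ (n : ℝ) * (1 - Real.sqrt ((γ : ℝ) / n)) - C / i - 1) := by
  have hγ' : (0 : ℝ) < γ := by exact_mod_cast hγ
  have hγn : (γ : ℝ) < n := by exact_mod_cast hn
  have hn' : (0 : ℝ) < n := hγ'.trans hγn
  set a := Real.sqrt ((γ : ℝ) / n) with ha_def
  have ha : 0 < a := Real.sqrt_pos.2 (by positivity)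
  have ha1 : a < 1 := by
    rw [ha_def, Real.sqrt_lt' one_pos, one_pow, div_lt_one hn']
    exact hγn
  have hγa : (γ : ℝ) = a ^ 2 * n := by
    rw [ha_def, Real.sq_sqrt (by positivity)]
    field_simp
  have hsqrt : Real.sqrt ((n : ℝ) * γ) = n * a := by
    rw [hγa, show (n : ℝ) * (a ^ 2 * n) = (n * a) ^ 2 by ring, Real.sqrt_sq (by positivity)]
  refine ⟨2 * n + 1 / a, by positivity, fun i hi s hs T hT => ?_⟩
  have hi' : (0 : ℝ) < i := by exact_mod_cast hi
  have hs' : (s : ℝ) = ⌊a * i⌋ + 1 := by rw [hs]; push_cast; rfl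
  have bound : |T - ((n : ℝ) - Real.sqrt ((n : ℝ) * γ))| ≤ (2 * n + 1 / a) / i := by
    rw [hT, hsqrt, hγa]
    exact abs_radius_sub_johnson_le hn' ha ha1 hi' (hs' ▸ Int.lt_floor_add_one _)
      (by linarith [Int.floor_le (a * i)])
  refine ⟨bound, ?_⟩
  rw [hsqrt] at bound
  linarith [(abs_le.1 bound).1, Int.sub_one_lt_floor T]
end
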